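/- Let N ≥ 2 be an integer, γ > −N, ν ∈ (0,2), R > 0, and let f : ℝ^N → [0,∞) be measurable satisfying the macroscopic bounds with constants M₁, M₀, E₀, H₀. Then there exist constants λ > 0 and μ > 0, depending only on N, γ, ν, M₀, M₁, E₀, H₀ and R, such that for every v ∈ B_R there is a measurable set A = A(v) ⊆ S^{N−1} with A = −A and surface measure |A| ≥ μ, such that K̄_f(v,v') ≥ λ |v'−v|^{−N−ν} whenever v' ≠ v and (v'−v)/|v'−v| ∈ A. -/

import Mathlib

open MeasureTheory Metric Set
open scoped ENNReal RealInnerProductSpace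

noncomputable section

/-- The Boltzmann kernel
`K̄_f(v,v') = |v'-v|^{-N-ν} ∫_{w ⊥ (v'-v)} f(v+w) |w|^{γ+ν+1} dS(w)`,
where the inner integral is over the hyperplane orthogonal to `v' - v` with respect to the
`(N-1)`-dimensional Hausdorff measure. -/
def Kbar (N : ℕ) (γ ν : ℝ) (f : EuclideanSpace ℝ (Fin N) → ℝ)
    (v v' : EuclideanSpace ℝ (Fin N)) : ℝ≥0∞ :=
  ENNReal.ofReal (‖v' - v‖ ^ (-(N : ℝ) - ν)) *
    ∫⁻ w in {w : EuclideanSpace ℝ (Fin N) | ⟪w, v' - v⟫ = 0},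
      ENNReal.ofReal (f (v + w) * ‖w‖ ^ (γ + ν + 1)) ∂(μH[(N : ℝ) - 1])

/-- The entropy bound `∫ f log f ≤ H₀`, stated in the extended sense: the positive part of
the integral minus the negative part is at most `H₀` (the inequality is arranged in `ℝ≥0∞`
so that it is meaningful even when the integral is `-∞`). -/
def EntropyLE (N : ℕ) (f : EuclideanSpace ℝ (Fin N) → ℝ) (H₀ : ℝ) : Prop :=
  (∫⁻ v, ENNReal.ofReal (f v * Real.log (f v))) + ENNReal.ofReal (-H₀) ≤
    (∫⁻ v, ENNReal.ofReal (-(f v * Real.log (f v)))) + ENNReal.ofReal H₀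

/-- The macroscopic bounds for the Boltzmann equation: mass between `M₁` and `M₀`,
energy at most `E₀` and entropy at most `H₀`. -/
def MacroBounds (N : ℕ) (f : EuclideanSpace ℝ (Fin N) → ℝ) (M₁ M₀ E₀ H₀ : ℝ) : Prop :=
  ENNReal.ofReal M₁ ≤ (∫⁻ v, ENNReal.ofReal (f v)) ∧
  (∫⁻ v, ENNReal.ofReal (f v)) ≤ ENNReal.ofReal M₀ ∧
  (∫⁻ v, ENNReal.ofReal (‖v‖ ^ 2 * f v)) ≤ ENNReal.ofReal E₀ ∧
  EntropyLE N f H₀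

/-- The vector of `ℝ^{n+1}` with first coordinate `t` and remaining coordinates `y`. -/
def consE {n : ℕ} (t : ℝ) (y : Fin n → ℝ) : EuclideanSpace ℝ (Fin (n + 1)) :=
  WithLp.toLp 2 (Fin.cons t y)

@[simp] lemma consE_zero {n : ℕ} (t : ℝ) (y : Fin n → ℝ) : consE t y 0 = t := rfl

@[simp] lemma consE_succ {n : ℕ} (t : ℝ) (y : Fin n → ℝ) (i : Fin n) :
    consE t y i.succ = y i := rfl

lemma consE_eta {n : ℕ} (w : EuclideanSpace ℝ (Fin (n + 1))) :
    consE (w 0) (fun i => w i.succ) = w := by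
  ext i
  refine Fin.cases rfl (fun i => rfl) i

lemma measurePreserving_finCons (n : ℕ) :
    MeasurePreserving (fun p : ℝ × (Fin n → ℝ) => (Fin.cons p.1 p.2 : Fin (n + 1) → ℝ)) := by
  convert! (volume_preserving_piFinSuccAbove (fun _ : Fin (n + 1) => ℝ) 0).symm using 1
  ext1 p
  exact (Fin.insertNth_zero (α := fun _ => ℝ) p.1 p.2).symm

lemma measurePreserving_consE (n : ℕ) :
    MeasurePreserving (fun p : ℝ × (Fin n → ℝ) => consE p.1 p.2) :=
  (PiLp.volume_preserving_toLp (Fin (n + 1))).comp (measurePreserving_finCons n)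

/-- Parametrization of the hyperplane `w 0 = - ∑ y i * w (i + 1)` by its last coordinates. -/
def hyperplaneGraph {n : ℕ} (y x : Fin n → ℝ) : EuclideanSpace ℝ (Fin (n + 1)) :=
  consE (-∑ i, y i * x i) x

lemma measurable_hyperplaneGraph (n : ℕ) :
    Measurable (fun p : (Fin n → ℝ) × (Fin n → ℝ) => hyperplaneGraph p.1 p.2) := by
  have h : Measurable (fun p : (Fin n → ℝ) × (Fin n → ℝ) => (-∑ i, p.1 i * p.2 i, p.2)) := by
    fun_prop
  exact (measurePreserving_consE n).measurable.comp h

lemma hausdorffMeasure_fin_eq_volume (n : ℕ) :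
    (μH[(n : ℝ)] : Measure (Fin n → ℝ)) = volume := by
  simpa using hausdorffMeasure_pi_real (ι := Fin n)

lemma lintegral_comp_hyperplaneGraph_le {n : ℕ} (y : Fin n → ℝ)
    {F : EuclideanSpace ℝ (Fin (n + 1)) → ℝ≥0∞} (hF : Measurable F) :
    ∫⁻ x, F (hyperplaneGraph y x) ≤
      ∫⁻ w in {w : EuclideanSpace ℝ (Fin (n + 1)) | w 0 = -∑ i, y i * w i.succ},
        F w ∂(μH[(n : ℝ)]) := by
  set H := {w : EuclideanSpace ℝ (Fin (n + 1)) | w 0 = -∑ i, y i * w i.succ}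
  have hHm : MeasurableSet H := measurableSet_eq_fun (by fun_prop) (by fun_prop)
  let π : EuclideanSpace ℝ (Fin (n + 1)) → Fin n → ℝ := fun w i => w i.succ
  have hπ : LipschitzWith 1 π := LipschitzWith.of_dist_le_mul fun a b => by
    rw [NNReal.coe_one, one_mul, dist_pi_le_iff dist_nonneg]
    intro i
    rw [dist_eq_norm, dist_eq_norm]
    exact PiLp.norm_apply_le (a - b) i.succ
  have hπm : Measurable π := hπ.continuous.measurable
  have hle : (volume : Measure (Fin n → ℝ)) ≤ ((μH[(n : ℝ)]).restrict H).map π := by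
    refine Measure.le_iff.2 fun B hB => ?_
    rw [Measure.map_apply hπm hB, Measure.restrict_apply (hπm hB),
      ← hausdorffMeasure_fin_eq_volume]
    have himage : B ⊆ π '' (π ⁻¹' B ∩ H) := fun x hx =>
      ⟨hyperplaneGraph y x, ⟨hx, rfl⟩, rfl⟩
    refine (measure_mono himage).trans ?_
    simpa using hπ.hausdorffMeasure_image_le (d := (n : ℝ)) (Nat.cast_nonneg n) (π ⁻¹' B ∩ H)
  have hG : Measurable fun x => F (hyperplaneGraph y x) :=
    hF.comp ((measurable_hyperplaneGraph n).comp (measurable_const.prodMk measurable_id))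
  calc ∫⁻ x, F (hyperplaneGraph y x)
      ≤ ∫⁻ x, F (hyperplaneGraph y x) ∂(((μH[(n : ℝ)]).restrict H).map π) :=
        lintegral_mono' hle le_rfl
    _ = ∫⁻ w in H, F (hyperplaneGraph y (π w)) ∂(μH[(n : ℝ)]) := lintegral_map hG hπm
    _ = ∫⁻ w in H, F w ∂(μH[(n : ℝ)]) := by
        refine setLIntegral_congr_fun hHm fun w hw => ?_
        have : hyperplaneGraph y (π w) = w := by
          rw [hyperplaneGraph, ← show w 0 = -∑ i, y i * π w i from hw]
          exact consE_eta w
        simp only [this]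

/-- The slopes of the hyperplanes used: the first one is in `[-L, L]`, the others in `[0, 1]`. -/
def slopeBox (m : ℕ) (L : ℝ) : Set (Fin (m + 1) → ℝ) :=
  Icc (Fin.cons (-L) 0) (Fin.cons L 1)

lemma mem_slopeBox {m : ℕ} {L : ℝ} {y : Fin (m + 1) → ℝ} :
    y ∈ slopeBox m L ↔ |y 0| ≤ L ∧ ∀ i : Fin m, y i.succ ∈ Icc (0 : ℝ) 1 := by
  simp only [slopeBox, mem_Icc, Pi.le_def, Fin.forall_fin_succ, Fin.cons_zero, Fin.cons_succ,
    abs_le, Pi.zero_apply, Pi.one_apply]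
  grind

lemma measurableSet_slopeBox (m : ℕ) (L : ℝ) : MeasurableSet (slopeBox m L) :=
  measurableSet_Icc

lemma volume_slopeBox (m : ℕ) (L : ℝ) : volume (slopeBox m L) = ENNReal.ofReal (2 * L) := by
  rw [slopeBox, Real.volume_Icc_pi, Fin.prod_univ_succ]
  simp [two_mul]

lemma volume_le_mul_volume_affine_preimage {r c s : ℝ} (hc : c ≠ 0) (hcr : |c| ≤ r)
    (T : Set ℝ) :
    volume T ≤ ENNReal.ofReal r * volume {a : ℝ | -(a * c + s) ∈ T} := by
  have h1 : {a : ℝ | -(a * c + s) ∈ T} = (fun a => -c * a) ⁻¹' ((fun t => t + -s) ⁻¹' T) := by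
    ext a
    simp only [mem_ofPred_eq, mem_preimage]
    ring_nf
  rw [h1, Real.volume_preimage_mul_left (neg_ne_zero.2 hc), measure_preimage_add_right,
    ← mul_assoc, ← ENNReal.ofReal_mul ((abs_nonneg c).trans hcr)]
  refine le_mul_of_one_le_left' ?_
  rw [ENNReal.one_le_ofReal, abs_inv, abs_neg, ← div_eq_mul_inv, one_le_div (abs_pos.2 hc)]
  exact hcr

lemma volume_le_mul_volume_slopes {m : ℕ} {r d L : ℝ} (hd : 0 < d)
    (hL : (m + 1) * r / d ≤ L) {x : Fin (m + 1) → ℝ} (hx : ∀ i, |x i| ≤ r) (hx0 : d ≤ |x 0|)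
    {T : Set ℝ} (hTm : MeasurableSet T) (hT : ∀ t ∈ T, |t| ≤ r) :
    volume T ≤ ENNReal.ofReal r *
      volume {y : Fin (m + 1) → ℝ | y ∈ slopeBox m L ∧ -∑ i, y i * x i ∈ T} := by
  set D := {y : Fin (m + 1) → ℝ | y ∈ slopeBox m L ∧ -∑ i, y i * x i ∈ T} with hD
  have hDm : MeasurableSet D :=
    (measurableSet_slopeBox m L).inter
      ((by fun_prop : Measurable fun y : Fin (m + 1) → ℝ => -∑ i, y i * x i) hTm)
  have hcons := measurePreserving_finCons m
  rw [← hcons.measure_preimage hDm.nullMeasurableSet,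
    Measure.volume_eq_prod, Measure.prod_apply_symm (hcons.measurable hDm),
    ← lintegral_const_mul' _ _ ENNReal.ofReal_ne_top]
  have hslice : ∀ b ∈ Icc (0 : Fin m → ℝ) 1, volume T ≤ ENNReal.ofReal r *
      volume ((fun a : ℝ => (a, b)) ⁻¹'
        ((fun p : ℝ × (Fin m → ℝ) => (Fin.cons p.1 p.2 : Fin (m + 1) → ℝ)) ⁻¹' D)) := by
    intro b hb
    have hc : x 0 ≠ 0 := abs_pos.1 (hd.trans_le hx0)
    refine (volume_le_mul_volume_affine_preimage (s := ∑ i, b i * x i.succ) hc (hx 0) T).trans ?_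
    gcongr
    intro a ha
    simp only [mem_ofPred_eq, mem_preimage, hD, mem_slopeBox, Fin.sum_univ_succ, Fin.cons_zero,
      Fin.cons_succ] at ha ⊢
    refine ⟨⟨?_, fun i => ⟨hb.1 i, hb.2 i⟩⟩, ha⟩
    have hs : |∑ i, b i * x i.succ| ≤ m * r := by
      refine (Finset.abs_sum_le_sum_abs _ _).trans ?_
      have : ∀ i ∈ Finset.univ, |b i * x i.succ| ≤ r := fun i _ => by
        rw [abs_mul, abs_of_nonneg (hb.1 i)]
        exact (mul_le_of_le_one_left (abs_nonneg _) (hb.2 i)).trans (hx _)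
      simpa using Finset.sum_le_card_nsmul _ _ _ this
    have h1 := hT _ ha
    rw [abs_neg] at h1
    have h2 : |a * x 0| ≤ (m + 1) * r := by
      have := abs_sub (a * x 0 + ∑ i, b i * x i.succ) (∑ i, b i * x i.succ)
      rw [add_sub_cancel_right] at this
      linarith
    rw [abs_mul] at h2
    refine le_trans ?_ hL
    rw [le_div_iff₀ hd]
    exact (mul_le_mul_of_nonneg_left hx0 (abs_nonneg a)).trans h2
  have hcube : volume (Icc (0 : Fin m → ℝ) 1) = 1 := by
    simp [Real.volume_Icc_pi]
  calc volume T = ∫⁻ _ in Icc (0 : Fin m → ℝ) 1, volume T := by simp [hcube]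
    _ ≤ _ := setLIntegral_mono' measurableSet_Icc hslice
    _ ≤ _ := setLIntegral_le_lintegral _ _

lemma volume_le_mul_lintegral_volume_section {m : ℕ} {r d L : ℝ} (hd : 0 < d)
    (hL : (m + 1) * r / d ≤ L) {S : Set (EuclideanSpace ℝ (Fin (m + 2)))}
    (hSm : MeasurableSet S) (hS : ∀ u ∈ S, (∀ i, |u i| ≤ r) ∧ d ≤ |u 1|) :
    volume S ≤ ENNReal.ofReal r *
      ∫⁻ y in slopeBox m L, volume {x : Fin (m + 1) → ℝ | hyperplaneGraph y x ∈ S} := by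
  have hcons := measurePreserving_consE (m + 1)
  have hgraph := measurable_hyperplaneGraph (m + 1)
  have hswap : ∫⁻ y in slopeBox m L, volume {x : Fin (m + 1) → ℝ | hyperplaneGraph y x ∈ S} =
      ∫⁻ x : Fin (m + 1) → ℝ, volume {y | y ∈ slopeBox m L ∧ hyperplaneGraph y x ∈ S} := by
    have h1 := Measure.prod_apply (μ := volume.restrict (slopeBox m L))
      (ν := (volume : Measure (Fin (m + 1) → ℝ))) (hgraph hSm)
    have h2 := Measure.prod_apply_symm (μ := volume.restrict (slopeBox m L))
      (ν := (volume : Measure (Fin (m + 1) → ℝ))) (hgraph hSm)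
    refine (h1.symm.trans h2).trans (lintegral_congr fun x => ?_)
    rw [Measure.restrict_apply]
    · congr 1
      ext y
      exact and_comm
    · exact (hgraph.comp (measurable_id.prodMk measurable_const)) hSm
  rw [hswap, ← hcons.measure_preimage hSm.nullMeasurableSet, Measure.volume_eq_prod,
    Measure.prod_apply_symm (hcons.measurable hSm),
    ← lintegral_const_mul' _ _ ENNReal.ofReal_ne_top]
  refine lintegral_mono fun x => ?_
  set T := (fun t : ℝ => (t, x)) ⁻¹' ((fun p : ℝ × (Fin (m + 1) → ℝ) => consE p.1 p.2) ⁻¹' S)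
  rcases T.eq_empty_or_nonempty with hT | ⟨t, ht⟩
  · simp [hT]
  · have hx := hS _ ht
    exact volume_le_mul_volume_slopes (T := T) hd hL (fun i => hx.1 i.succ) hx.2
      ((hcons.measurable.comp (measurable_id.prodMk measurable_const)) hSm)
      (fun s hs => (hS _ hs).1 0)

/-- The slope `(e₁ / e₀, …, eₙ / e₀)` of the hyperplane orthogonal to `e`. -/
def normalSlope {n : ℕ} (e : EuclideanSpace ℝ (Fin (n + 1))) : Fin n → ℝ :=
  fun i => e i.succ / e 0

lemma measurable_normalSlope (n : ℕ) :
    Measurable (normalSlope : EuclideanSpace ℝ (Fin (n + 1)) → Fin n → ℝ) :=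
  measurable_pi_iff.2 fun i => by unfold normalSlope; fun_prop

lemma normalSlope_smul {n : ℕ} {c : ℝ} (hc : c ≠ 0) (e : EuclideanSpace ℝ (Fin (n + 1))) :
    normalSlope (c • e) = normalSlope e := by
  ext i
  simp only [normalSlope, PiLp.smul_apply, smul_eq_mul]
  exact mul_div_mul_left _ _ hc

/-- The unit normals of the hyperplanes with slope in `Y`. -/
def normalDirections {n : ℕ} (Y : Set (Fin n → ℝ)) : Set (EuclideanSpace ℝ (Fin (n + 1))) :=
  {e | e ∈ sphere (0 : EuclideanSpace ℝ (Fin (n + 1))) 1 ∧ e 0 ≠ 0 ∧ normalSlope e ∈ Y}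

lemma measurableSet_normalDirections {n : ℕ} {Y : Set (Fin n → ℝ)} (hY : MeasurableSet Y) :
    MeasurableSet (normalDirections Y) := by
  refine isClosed_sphere.measurableSet.inter (MeasurableSet.inter ?_ (measurable_normalSlope n hY))
  exact (by fun_prop : Measurable fun e : EuclideanSpace ℝ (Fin (n + 1)) => e 0)
    (measurableSet_singleton 0).compl

lemma neg_normalDirections {n : ℕ} (Y : Set (Fin n → ℝ)) :
    -normalDirections Y = normalDirections Y := by
  ext e
  have h : normalSlope (-e) = normalSlope e := by
    rw [← neg_one_smul ℝ e, normalSlope_smul (by norm_num)]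
  simp [normalDirections, h]

lemma sq_mul_le_of_abs_normalSlope_le {n : ℕ} {L : ℝ} {e : EuclideanSpace ℝ (Fin (n + 1))}
    (he : ‖e‖ = 1) (he0 : e 0 ≠ 0) (hL : ∀ i, |normalSlope e i| ≤ L) :
    1 ≤ (1 + n * L ^ 2) * e 0 ^ 2 := by
  have h1 := EuclideanSpace.norm_sq_eq e
  rw [he, Fin.sum_univ_succ] at h1
  simp only [Real.norm_eq_abs, sq_abs] at h1
  have h2 : ∀ i ∈ Finset.univ, e (Fin.succ i) ^ 2 ≤ L ^ 2 * e 0 ^ 2 := fun i _ => by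
    have h3 : e i.succ = normalSlope e i * e 0 := by
      simp only [normalSlope]
      field_simp
    rw [h3, mul_pow]
    exact mul_le_mul_of_nonneg_right (sq_le_sq.2 ((hL i).trans (le_abs_self L))) (sq_nonneg _)
  have h4 := Finset.sum_le_card_nsmul _ _ _ h2
  simp only [Finset.card_univ, Fintype.card_fin, nsmul_eq_mul] at h4
  linarith

lemma volume_le_mul_hausdorffMeasure_normalDirections {n : ℕ} {L : ℝ}
    {Y : Set (Fin n → ℝ)} (hY : ∀ y ∈ Y, ∀ i, |y i| ≤ L) :
    volume Y ≤
      ENNReal.ofReal (2 * (1 + n * L ^ 2)) ^ (n : ℝ) * μH[(n : ℝ)] (normalDirections Y) := by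
  set κ := 1 + n * L ^ 2 with hκ
  have hκ0 : 0 ≤ 2 * κ := by positivity
  have hlip : LipschitzOnWith (2 * κ).toNNReal normalSlope
      (normalDirections Y ∩ {e | 0 < e 0}) := by
    refine LipschitzOnWith.of_dist_le_mul fun a ha b hb => ?_
    rw [Real.coe_toNNReal _ hκ0, dist_pi_le_iff (by positivity)]
    intro i
    obtain ⟨⟨ha1, -, haY⟩, ha0 : 0 < a 0⟩ := ha
    obtain ⟨⟨hb1, -, hbY⟩, hb0 : 0 < b 0⟩ := hb
    rw [mem_sphere_zero_iff_norm] at ha1 hb1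
    have ka := sq_mul_le_of_abs_normalSlope_le ha1 ha0.ne' (hY _ haY)
    have kb := sq_mul_le_of_abs_normalSlope_le hb1 hb0.ne' (hY _ hbY)
    rw [← hκ] at ka kb
    have hκab : 1 ≤ κ * (a 0 * b 0) := by
      rw [← abs_of_nonneg (by positivity : 0 ≤ κ * (a 0 * b 0)), ← one_le_sq_iff_one_le_abs]
      calc (1 : ℝ) ≤ (κ * a 0 ^ 2) * (κ * b 0 ^ 2) := one_le_mul_of_one_le_of_one_le ka kb
        _ = _ := by ring
    have hcoord : ∀ j, |a j - b j| ≤ dist a b := fun j => by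
      rw [dist_eq_norm]
      exact PiLp.norm_apply_le (a - b) j
    have hai : |a i.succ| ≤ 1 := ha1 ▸ PiLp.norm_apply_le a i.succ
    have ha0' : |a 0| ≤ 1 := ha1 ▸ PiLp.norm_apply_le a 0
    have hnum : |a i.succ * b 0 - a 0 * b i.succ| ≤ 2 * dist a b := by
      have h : a i.succ * b 0 - a 0 * b i.succ =
          a 0 * (a i.succ - b i.succ) - a i.succ * (a 0 - b 0) := by ring
      rw [h]
      refine (abs_sub _ _).trans ?_
      rw [abs_mul, abs_mul, two_mul]
      exact add_le_add
        ((mul_le_of_le_one_left (abs_nonneg _) ha0').trans (hcoord _))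
        ((mul_le_of_le_one_left (abs_nonneg _) hai).trans (hcoord _))
    rw [Real.dist_eq, normalSlope, normalSlope, div_sub_div _ _ ha0.ne' hb0.ne', abs_div,
      abs_of_pos (mul_pos ha0 hb0), div_le_iff₀ (mul_pos ha0 hb0)]
    have := mul_le_mul_of_nonneg_left hκab (by positivity : 0 ≤ 2 * dist a b)
    linarith
  have himage : Y ⊆ normalSlope '' (normalDirections Y ∩ {e | 0 < e 0}) := by
    intro y hy
    have hpos : 0 < ‖consE 1 y‖⁻¹ := by
      refine inv_pos.2 (norm_pos_iff.2 fun h => ?_)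
      simpa using congrArg (fun w : EuclideanSpace ℝ (Fin (n + 1)) => w 0) h
    have hslope : normalSlope (‖consE 1 y‖⁻¹ • consE 1 y) = y := by
      rw [normalSlope_smul hpos.ne']
      ext i
      simp [normalSlope]
    have h0 : 0 < (‖consE 1 y‖⁻¹ • consE 1 y) 0 := by simpa using hpos
    refine ⟨_, ⟨⟨?_, h0.ne', by rwa [hslope]⟩, h0⟩, hslope⟩
    rw [mem_sphere_zero_iff_norm, norm_smul, norm_inv, norm_norm,
      inv_mul_cancel₀ (inv_pos.1 hpos).ne']
  rw [← hausdorffMeasure_fin_eq_volume]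
  calc (μH[(n : ℝ)] : Measure (Fin n → ℝ)) Y
      ≤ μH[(n : ℝ)] (normalSlope '' (normalDirections Y ∩ {e | 0 < e 0})) := measure_mono himage
    _ ≤ _ := hlip.hausdorffMeasure_image_le (Nat.cast_nonneg n)
    _ ≤ _ := mul_le_mul_right (measure_mono inter_subset_left) _

lemma neg_mul_log_le_add_exp {a t : ℝ} (ha : 0 ≤ a) (ht : 0 ≤ t) :
    -(a * Real.log a) ≤ t * a + Real.exp (-t / 2) := by
  rcases ha.eq_or_lt with rfl | ha
  · simpa using (Real.exp_pos _).le
  rcases le_or_gt (Real.exp (-t)) a with h | h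
  · have h1 : -t ≤ Real.log a := (Real.le_log_iff_exp_le ha).2 h
    have h2 := mul_le_mul_of_nonneg_left h1 ha.le
    have h3 := Real.exp_pos (-t / 2)
    linarith
  · have h1 : √a ≤ Real.exp (-t / 2) := by
      rw [Real.exp_half]
      exact Real.sqrt_le_sqrt h.le
    have h2 : -(a * Real.log a) ≤ √a := by
      have hs := Real.sqrt_pos.2 ha
      have h6 : Real.log a = 2 * Real.log (√a) := by
        rw [Real.log_sqrt ha.le]
        ring
      have h7 : Real.log (1 / √a) ≤ (1 / √a) / 2 := by
        have h8 := Real.log_le_sub_one_of_pos (show 0 < (1 / √a) / 2 by positivity)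
        rw [Real.log_div (by positivity) two_ne_zero] at h8
        linarith [Real.log_two_lt_d9]
      rw [one_div, Real.log_inv] at h7
      have h9 := mul_le_mul_of_nonneg_left h7 (by positivity : 0 ≤ 2 * a)
      have h10 : 2 * a * ((√a)⁻¹ / 2) = √a := by
        nth_rewrite 1 [← Real.mul_self_sqrt ha.le]
        field_simp
      rw [h10] at h9
      rw [h6]
      linarith
    have h3 : 0 ≤ t * a := by positivity
    linarith

lemma integrable_exp_neg_norm_sq_half (N : ℕ) :
    Integrable fun x : EuclideanSpace ℝ (Fin N) => Real.exp (-‖x‖ ^ 2 / 2) := by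
  have h := (GaussianFourier.integrable_cexp_neg_mul_sq_norm_add (b := 1 / 2)
    (V := EuclideanSpace ℝ (Fin N)) (by norm_num) 0 0).norm
  refine h.congr (Filter.Eventually.of_forall fun x => ?_)
  simp only [Complex.norm_exp]
  congr 1
  have h2 : (-(1 / 2 : ℂ) * (‖x‖ : ℂ) ^ 2 + 0 * ((⟪(0 : EuclideanSpace ℝ (Fin N)), x⟫ : ℝ) : ℂ)) =
      ((-‖x‖ ^ 2 / 2 : ℝ) : ℂ) := by
    push_cast
    ring
  rw [h2, Complex.ofReal_re]

/-- A bound on `∫ f log⁺ f` depending only on the energy and entropy bounds. -/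
lemma exists_lintegral_mul_log_le (N : ℕ) (M₁ M₀ E₀ H₀ : ℝ) (hE₀ : 0 < E₀) :
    ∃ C : ℝ, 0 < C ∧ ∀ f : EuclideanSpace ℝ (Fin N) → ℝ, Measurable f → (∀ v, 0 ≤ f v) →
      MacroBounds N f M₁ M₀ E₀ H₀ →
      ∫⁻ v, ENNReal.ofReal (f v * Real.log (f v)) ≤ ENNReal.ofReal C := by
  set G := ∫ x : EuclideanSpace ℝ (Fin N), Real.exp (-‖x‖ ^ 2 / 2) with hG
  have hG0 : 0 ≤ G := integral_nonneg fun x => (Real.exp_pos _).le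
  refine ⟨E₀ + G + |H₀|, by positivity, fun f hf hf0 ⟨_, _, hE, hH⟩ => ?_⟩
  have hneg : ∫⁻ v, ENNReal.ofReal (-(f v * Real.log (f v))) ≤
      ENNReal.ofReal E₀ + ENNReal.ofReal G := by
    rw [hG, ofReal_integral_eq_lintegral_ofReal (integrable_exp_neg_norm_sq_half N)
      (Filter.Eventually.of_forall fun x => (Real.exp_pos _).le)]
    refine le_trans ?_ (add_le_add_left hE _)
    rw [← lintegral_add_left (by fun_prop)]
    refine lintegral_mono fun v => ?_
    rw [← ENNReal.ofReal_add (mul_nonneg (sq_nonneg _) (hf0 v)) (Real.exp_pos _).le]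
    exact ENNReal.ofReal_le_ofReal (neg_mul_log_le_add_exp (hf0 v) (sq_nonneg _))
  calc ∫⁻ v, ENNReal.ofReal (f v * Real.log (f v))
      ≤ (∫⁻ v, ENNReal.ofReal (-(f v * Real.log (f v)))) + ENNReal.ofReal H₀ :=
        le_self_add.trans hH
    _ ≤ ENNReal.ofReal E₀ + ENNReal.ofReal G + ENNReal.ofReal |H₀| :=
        add_le_add hneg (ENNReal.ofReal_le_ofReal (le_abs_self _))
    _ = _ := by
        rw [← ENNReal.ofReal_add hE₀.le hG0, ← ENNReal.ofReal_add (by positivity) (abs_nonneg _)]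

lemma volume_box_le {m : ℕ} {r d c : ℝ} (hr : 0 ≤ r) (hd : 0 ≤ d)
    {S : Set (EuclideanSpace ℝ (Fin (m + 2)))}
    (hS : ∀ x ∈ S, ‖x‖ ≤ r ∧ |x 1 - c| ≤ d) :
    volume S ≤ ENNReal.ofReal (2 * d * (2 * r) ^ (m + 1)) := by
  let J : Fin (m + 2) → Set ℝ := fun i => if i = 1 then Icc (c - d) (c + d) else Icc (-r) r
  have hJm : MeasurableSet (univ.pi J) := MeasurableSet.univ_pi fun i => by
    dsimp only [J]
    split_ifs <;> exact measurableSet_Icc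
  have hsub : S ⊆ WithLp.ofLp ⁻¹' univ.pi J := by
    intro x hx i _
    dsimp only [J]
    split_ifs with hi
    · subst hi
      have := abs_le.1 (hS x hx).2
      exact ⟨by linarith, by linarith⟩
    · exact abs_le.1 ((PiLp.norm_apply_le x i).trans (hS x hx).1)
  refine (measure_mono hsub).trans ?_
  rw [(PiLp.volume_preserving_ofLp (Fin (m + 2))).measure_preimage hJm.nullMeasurableSet,
    volume_pi_pi, ← Finset.mul_prod_erase _ _ (Finset.mem_univ (1 : Fin (m + 2)))]
  have h1 : volume (J 1) = ENNReal.ofReal (2 * d) := by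
    simp only [J, if_true, Real.volume_Icc]
    ring_nf
  have h2 : ∀ i ∈ Finset.univ.erase (1 : Fin (m + 2)), volume (J i) = ENNReal.ofReal (2 * r) := by
    intro i hi
    simp only [J, if_neg (Finset.ne_of_mem_erase hi), Real.volume_Icc]
    ring_nf
  rw [h1, Finset.prod_congr rfl h2, Finset.prod_const, Finset.card_erase_of_mem (Finset.mem_univ _),
    Finset.card_univ, Fintype.card_fin, ENNReal.ofReal_mul (p := 2 * d) (by positivity),
    ENNReal.ofReal_pow (by positivity)]
  rfl

/-- Splitting of a density into tail, large values, a slab around a hyperplane, small values and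
the remaining good set. -/
lemma ofReal_le_splitting {m : ℕ} {f : EuclideanSpace ℝ (Fin (m + 2)) → ℝ} (hf0 : ∀ v, 0 ≤ f v)
    {r d l k c : ℝ} (hr : 0 < r) (hk : 0 < k) (x : EuclideanSpace ℝ (Fin (m + 2))) :
    ENNReal.ofReal (f x) ≤ ENNReal.ofReal (r ^ 2)⁻¹ * ENNReal.ofReal (‖x‖ ^ 2 * f x) +
      ENNReal.ofReal k⁻¹ * ENNReal.ofReal (f x * Real.log (f x)) +
      {x | ‖x‖ ≤ r ∧ |x 1 - c| ≤ d}.indicator (fun _ => ENNReal.ofReal (Real.exp k)) x +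
      {x | ‖x‖ ≤ r ∧ |x 1 - 0| ≤ r}.indicator (fun _ => ENNReal.ofReal l) x +
      {x | ‖x‖ ≤ r ∧ d ≤ |x 1 - c| ∧ l ≤ f x}.indicator
        (fun _ => ENNReal.ofReal (Real.exp k)) x := by
  rcases lt_or_ge r ‖x‖ with h1 | h1
  · refine le_trans ?_ (le_add_right (le_add_right (le_add_right le_self_add)))
    rw [← ENNReal.ofReal_mul (by positivity)]
    refine ENNReal.ofReal_le_ofReal ?_
    rw [← mul_assoc, ← div_eq_inv_mul]
    refine le_mul_of_one_le_left (hf0 x) ?_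
    rw [one_le_div (by positivity)]
    gcongr
  rcases lt_or_ge (Real.exp k) (f x) with h2 | h2
  · refine le_trans ?_ (le_add_right (le_add_right (le_add_right le_add_self)))
    rw [← ENNReal.ofReal_mul (by positivity)]
    refine ENNReal.ofReal_le_ofReal ?_
    rw [mul_left_comm]
    refine le_mul_of_one_le_right (hf0 x) ?_
    rw [← div_eq_inv_mul, one_le_div hk, Real.le_log_iff_exp_le ((Real.exp_pos k).trans h2)]
    exact h2.le
  rcases le_or_gt |x 1 - c| d with h3 | h3
  · refine le_trans ?_ (le_add_right (le_add_right le_add_self))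
    rw [indicator_of_mem (show x ∈ {x | ‖x‖ ≤ r ∧ |x 1 - c| ≤ d} from ⟨h1, h3⟩)]
    exact ENNReal.ofReal_le_ofReal h2
  rcases lt_or_ge (f x) l with h4 | h4
  · refine le_trans ?_ (le_add_right le_add_self)
    rw [indicator_of_mem (show x ∈ {x | ‖x‖ ≤ r ∧ |x 1 - 0| ≤ r} from
      ⟨h1, by simpa using (PiLp.norm_apply_le x 1).trans h1⟩)]
    exact ENNReal.ofReal_le_ofReal h4.le
  · refine le_trans ?_ le_add_self
    rw [indicator_of_mem (show x ∈ {x | ‖x‖ ≤ r ∧ d ≤ |x 1 - c| ∧ l ≤ f x} from ⟨h1, h3.le, h4⟩)]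
    exact ENNReal.ofReal_le_ofReal h2

/-- The macroscopic bounds give a quantitative lower bound on the measure of a set where `f` is
bounded below, which stays in a ball and away from the hyperplane `x 1 = v 1`. -/
lemma exists_volume_levelSet_ge (m : ℕ) (R M₁ M₀ E₀ H₀ : ℝ) (hR : 0 < R) (hM₁ : 0 < M₁)
    (hE₀ : 0 < E₀) :
    ∃ r d l c : ℝ, 0 < r ∧ 0 < d ∧ 0 < l ∧ 0 < c ∧
      ∀ f : EuclideanSpace ℝ (Fin (m + 2)) → ℝ, Measurable f → (∀ v, 0 ≤ f v) →
        MacroBounds (m + 2) f M₁ M₀ E₀ H₀ →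
        ∀ v ∈ ball (0 : EuclideanSpace ℝ (Fin (m + 2))) R,
          ∃ S : Set (EuclideanSpace ℝ (Fin (m + 2))), MeasurableSet S ∧
            ENNReal.ofReal c ≤ volume S ∧ ∀ u ∈ S, ‖u‖ ≤ r ∧ d ≤ |u 1| ∧ l ≤ f (v + u) := by
  obtain ⟨C, hC, hent⟩ := exists_lintegral_mul_log_le (m + 2) M₁ M₀ E₀ H₀ hE₀
  set r := √(8 * E₀ / M₁) with hr
  have hr0 : 0 < r := Real.sqrt_pos.2 (by positivity)
  have hr2 : r ^ 2 = 8 * E₀ / M₁ := Real.sq_sqrt (by positivity)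
  set k := 8 * C / M₁ with hk
  have hk0 : 0 < k := by positivity
  set K := Real.exp k with hK
  have hK0 : 0 < K := Real.exp_pos k
  set d := M₁ / (8 * K * 2 * (2 * r) ^ (m + 1)) with hd
  have hd0 : 0 < d := by positivity
  set l := M₁ / (8 * 2 * r * (2 * r) ^ (m + 1)) with hl
  have hl0 : 0 < l := by positivity
  refine ⟨r + R, d, l, M₁ / (2 * K), by positivity, hd0, hl0, by positivity, ?_⟩
  intro f hf hf0 hmac v hv
  have hv' : ‖v‖ < R := by simpa using hv
  set S := {x : EuclideanSpace ℝ (Fin (m + 2)) | ‖x‖ ≤ r ∧ d ≤ |x 1 - v 1| ∧ l ≤ f x} with hS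
  have hSm : MeasurableSet S := by
    refine (measurableSet_le measurable_norm measurable_const).inter
      ((measurableSet_le (g := fun x : EuclideanSpace ℝ (Fin (m + 2)) => |x 1 - v 1|)
        measurable_const ?_).inter (measurableSet_le measurable_const hf))
    fun_prop
  have hslab : ∀ a b : ℝ, MeasurableSet
      {x : EuclideanSpace ℝ (Fin (m + 2)) | ‖x‖ ≤ r ∧ |x 1 - a| ≤ b} := fun a b => by
    refine (measurableSet_le measurable_norm measurable_const).inter
      (measurableSet_le (f := fun x : EuclideanSpace ℝ (Fin (m + 2)) => |x 1 - a|) ?_ measurable_const)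
    fun_prop
  have hmass := hmac.1.trans (lintegral_mono fun x =>
    ofReal_le_splitting hf0 (r := r) (d := d) (l := l) (k := k) (c := v 1) hr0 hk0 x)
  rw [lintegral_add_right _ (measurable_const.indicator hSm),
    lintegral_add_right _ (measurable_const.indicator (hslab _ _)),
    lintegral_add_right _ (measurable_const.indicator (hslab _ _)),
    lintegral_add_left (by fun_prop), lintegral_const_mul _ (by fun_prop),
    lintegral_const_mul _ (by fun_prop), lintegral_indicator_const (hslab _ _),
    lintegral_indicator_const (hslab _ _), lintegral_indicator_const hSm] at hmass
  have b1 : ENNReal.ofReal (r ^ 2)⁻¹ * ∫⁻ x, ENNReal.ofReal (‖x‖ ^ 2 * f x) ≤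
      ENNReal.ofReal (M₁ / 8) := by
    refine (mul_le_mul_right hmac.2.2.1 _).trans (le_of_eq ?_)
    rw [← ENNReal.ofReal_mul (by positivity), hr2]
    congr 1
    field_simp
  have b2 : ENNReal.ofReal k⁻¹ * ∫⁻ x, ENNReal.ofReal (f x * Real.log (f x)) ≤
      ENNReal.ofReal (M₁ / 8) := by
    refine (mul_le_mul_right (hent f hf hf0 hmac) _).trans (le_of_eq ?_)
    rw [← ENNReal.ofReal_mul (by positivity), hk]
    congr 1
    field_simp
  have b3 : ENNReal.ofReal K * volume {x : EuclideanSpace ℝ (Fin (m + 2)) |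
      ‖x‖ ≤ r ∧ |x 1 - v 1| ≤ d} ≤ ENNReal.ofReal (M₁ / 8) := by
    refine (mul_le_mul_right (volume_box_le hr0.le hd0.le fun x hx => hx) _).trans (le_of_eq ?_)
    rw [← ENNReal.ofReal_mul (by positivity), hd]
    congr 1
    field_simp
  have b4 : ENNReal.ofReal l * volume {x : EuclideanSpace ℝ (Fin (m + 2)) |
      ‖x‖ ≤ r ∧ |x 1 - 0| ≤ r} ≤ ENNReal.ofReal (M₁ / 8) := by
    refine (mul_le_mul_right (volume_box_le hr0.le hr0.le fun x hx => hx) _).trans (le_of_eq ?_)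
    rw [← ENNReal.ofReal_mul (by positivity), hl]
    congr 1
    field_simp
  have hvol : ENNReal.ofReal (M₁ / (2 * K)) ≤ volume S := by
    by_contra! hlt
    have b5 : ENNReal.ofReal K * volume S < ENNReal.ofReal (M₁ / 2) := by
      calc ENNReal.ofReal K * volume S < ENNReal.ofReal K * ENNReal.ofReal (M₁ / (2 * K)) :=
            ENNReal.mul_lt_mul_right (by simpa using hK0) ENNReal.ofReal_ne_top hlt
        _ = ENNReal.ofReal (M₁ / 2) := by
            rw [← ENNReal.ofReal_mul hK0.le]
            congr 1
            field_simp
    have b6 := hmass.trans_lt (ENNReal.add_lt_add_of_le_of_lt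
      (ne_top_of_le_ne_top (by finiteness)
        (add_le_add (add_le_add (add_le_add b1 b2) b3) b4))
      (add_le_add (add_le_add (add_le_add b1 b2) b3) b4) b5)
    rw [← ENNReal.ofReal_add (by positivity) (by positivity),
      ← ENNReal.ofReal_add (by positivity) (by positivity),
      ← ENNReal.ofReal_add (by positivity) (by positivity),
      ← ENNReal.ofReal_add (by positivity) (by positivity)] at b6
    refine b6.ne ?_
    congr 1
    ring
  refine ⟨(fun u => v + u) ⁻¹' S, (measurable_const_add v) hSm, ?_, fun u hu => ⟨?_, ?_, hu.2.2⟩⟩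
  · rwa [measure_preimage_add]
  · have := norm_sub_le (v + u) v
    rw [add_sub_cancel_left] at this
    linarith [hu.1]
  · simpa using hu.2.1

lemma min_rpow_le_rpow {d r t : ℝ} (a : ℝ) (hd : 0 < d) (hdt : d ≤ t) (htr : t ≤ r) :
    min (d ^ a) (r ^ a) ≤ t ^ a := by
  rcases le_total 0 a with ha | ha
  · exact (min_le_left _ _).trans (Real.rpow_le_rpow hd.le hdt ha)
  · exact (min_le_right _ _).trans (Real.rpow_le_rpow_of_nonpos (hd.trans_le hdt) htr ha)

lemma inner_eq_zero_iff_of_slope {n : ℕ} {z : EuclideanSpace ℝ (Fin (n + 1))} (hz : z 0 ≠ 0)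
    (w : EuclideanSpace ℝ (Fin (n + 1))) :
    ⟪w, z⟫ = 0 ↔ w 0 = -∑ i, normalSlope z i * w i.succ := by
  have h : ⟪w, z⟫ = z 0 * (w 0 + ∑ i, normalSlope z i * w i.succ) := by
    rw [PiLp.inner_apply, Fin.sum_univ_succ, mul_add, Finset.mul_sum]
    congr 1
    refine Finset.sum_congr rfl fun i _ => ?_
    simp only [normalSlope, RCLike.inner_apply, conj_trivial]
    field_simp
  rw [h, mul_eq_zero, or_iff_right hz, eq_neg_iff_add_eq_zero]

lemma mul_volume_section_le_Kbar {n : ℕ} {γ ν : ℝ} {f : EuclideanSpace ℝ (Fin (n + 1)) → ℝ}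
    (hf : Measurable f) {S : Set (EuclideanSpace ℝ (Fin (n + 1)))} (hSm : MeasurableSet S)
    {v v' : EuclideanSpace ℝ (Fin (n + 1))} {b : ℝ}
    (hS : ∀ u ∈ S, b ≤ f (v + u) * ‖u‖ ^ (γ + ν + 1)) (h0 : (v' - v) 0 ≠ 0) :
    ENNReal.ofReal (‖v' - v‖ ^ (-((n + 1 : ℕ) : ℝ) - ν)) *
      (ENNReal.ofReal b * volume {x : Fin n → ℝ | hyperplaneGraph (normalSlope (v' - v)) x ∈ S}) ≤
        Kbar (n + 1) γ ν f v v' := by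
  set y := normalSlope (v' - v)
  set F : EuclideanSpace ℝ (Fin (n + 1)) → ℝ≥0∞ :=
    fun w => ENNReal.ofReal (f (v + w) * ‖w‖ ^ (γ + ν + 1))
  have hFm : Measurable F := by fun_prop
  have hgraph : Measurable (hyperplaneGraph y) :=
    (measurable_hyperplaneGraph n).comp (measurable_const.prodMk measurable_id)
  have hplane : {w : EuclideanSpace ℝ (Fin (n + 1)) | ⟪w, v' - v⟫ = 0} =
      {w | w 0 = -∑ i, y i * w i.succ} := by
    ext w
    exact inner_eq_zero_iff_of_slope h0 w
  have hdim : (((n + 1 : ℕ) : ℝ) - 1) = n := by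
    push_cast
    ring
  rw [Kbar, hplane, hdim]
  gcongr
  calc ENNReal.ofReal b * volume {x : Fin n → ℝ | hyperplaneGraph y x ∈ S}
      = ∫⁻ _ in hyperplaneGraph y ⁻¹' S, ENNReal.ofReal b := (setLIntegral_const _ _).symm
    _ ≤ ∫⁻ x in hyperplaneGraph y ⁻¹' S, F (hyperplaneGraph y x) :=
        setLIntegral_mono' (hgraph hSm) fun x hx => ENNReal.ofReal_le_ofReal (hS _ hx)
    _ ≤ ∫⁻ x, F (hyperplaneGraph y x) := setLIntegral_le_lintegral _ _
    _ ≤ _ := lintegral_comp_hyperplaneGraph_le y hFm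

/-- Many slopes in the box give hyperplanes meeting `S` in a set of large measure. -/
lemma volume_slopes_ge {m : ℕ} {r d L c : ℝ} (hr : 0 < r) (hd : 0 < d) (hL0 : 0 < L)
    (hL : (m + 1) * r / d ≤ L) (hc : 0 < c) {S : Set (EuclideanSpace ℝ (Fin (m + 2)))}
    (hSm : MeasurableSet S) (hS : ∀ u ∈ S, (∀ i, |u i| ≤ r) ∧ d ≤ |u 1|)
    (hcS : ENNReal.ofReal c ≤ volume S) :
    ∃ Y ⊆ slopeBox m L, MeasurableSet Y ∧
      ENNReal.ofReal (c / (2 * r * (2 * r) ^ (m + 1))) ≤ volume Y ∧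
      ∀ y ∈ Y, ENNReal.ofReal (c / (4 * r * L)) ≤
        volume {x : Fin (m + 1) → ℝ | hyperplaneGraph y x ∈ S} := by
  set G : (Fin (m + 1) → ℝ) → ℝ≥0∞ := fun y => volume {x | hyperplaneGraph y x ∈ S} with hG
  have hGm : Measurable G := measurable_measure_prodMk_left (measurable_hyperplaneGraph _ hSm)
  set l := c / (4 * r * L) with hl
  set g := (2 * r) ^ (m + 1) with hg
  have hg0 : 0 < g := by positivity
  have hGle : ∀ y, G y ≤ ENNReal.ofReal g := fun y => by
    have hsub : {x : Fin (m + 1) → ℝ | hyperplaneGraph y x ∈ S} ⊆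
        Icc (fun _ => -r) (fun _ => r) := fun x hx =>
      ⟨fun i => (abs_le.1 ((hS _ hx).1 i.succ)).1, fun i => (abs_le.1 ((hS _ hx).1 i.succ)).2⟩
    refine (measure_mono hsub).trans (le_of_eq ?_)
    rw [hg, ENNReal.ofReal_pow (by positivity), Real.volume_Icc_pi]
    simp [two_mul]
  set Y := slopeBox m L ∩ {y | ENNReal.ofReal l ≤ G y} with hY
  have hYm : MeasurableSet Y :=
    (measurableSet_slopeBox m L).inter (measurableSet_le measurable_const hGm)
  refine ⟨Y, inter_subset_left, hYm, ?_, fun y hy => hy.2⟩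
  have hint : ∫⁻ y in slopeBox m L, G y ≤
      ENNReal.ofReal g * volume Y + ENNReal.ofReal l * ENNReal.ofReal (2 * L) := by
    calc ∫⁻ y in slopeBox m L, G y
        ≤ ∫⁻ y in slopeBox m L, (Y.indicator (fun _ => ENNReal.ofReal g) y + ENNReal.ofReal l) := by
          refine setLIntegral_mono' (measurableSet_slopeBox m L) fun y hy => ?_
          rcases le_or_gt (ENNReal.ofReal l) (G y) with h | h
          · rw [indicator_of_mem (show y ∈ Y from ⟨hy, h⟩)]
            exact le_add_right (hGle y)
          · exact le_add_left h.le
      _ = (∫⁻ y in slopeBox m L, Y.indicator (fun _ => ENNReal.ofReal g) y) +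
            ENNReal.ofReal l * ENNReal.ofReal (2 * L) := by
          rw [lintegral_add_right _ measurable_const, setLIntegral_const, volume_slopeBox]
      _ ≤ _ := by
          gcongr
          exact (setLIntegral_le_lintegral _ _).trans_eq (lintegral_indicator_const hYm _)
  by_contra! hlt
  have h1 : ENNReal.ofReal g * volume Y < ENNReal.ofReal (c / (2 * r)) := by
    calc ENNReal.ofReal g * volume Y < ENNReal.ofReal g * ENNReal.ofReal (c / (2 * r * g)) :=
          ENNReal.mul_lt_mul_right (by simpa using hg0) ENNReal.ofReal_ne_top hlt
      _ = _ := by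
          rw [← ENNReal.ofReal_mul (by positivity)]
          congr 1
          field_simp
  have h2 : ∫⁻ y in slopeBox m L, G y < ENNReal.ofReal (c / r) := by
    refine hint.trans_lt ((ENNReal.add_lt_add_right (by finiteness) h1).trans_eq ?_)
    rw [← ENNReal.ofReal_mul (by positivity), ← ENNReal.ofReal_add (by positivity) (by positivity)]
    congr 1
    rw [hl]
    field_simp
    ring
  have h3 : ENNReal.ofReal r * ∫⁻ y in slopeBox m L, G y < ENNReal.ofReal c := by
    refine (ENNReal.mul_lt_mul_right (by simpa using hr) ENNReal.ofReal_ne_top h2).trans_eq ?_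
    rw [← ENNReal.ofReal_mul hr.le, mul_div_cancel₀ _ hr.ne']
  exact (hcS.trans (volume_le_mul_lintegral_volume_section hd hL hSm hS)).not_gt h3

/-- **Cone of directions lower bound for the Boltzmann kernel** (Lemma 4.8 of the paper).
If `f` satisfies the macroscopic bounds, then for every `v ∈ B_R` there is a symmetric
subset `A` of the unit sphere of measure at least `μ` such that
`K̄_f(v,v') ≥ λ |v'-v|^{-N-ν}` whenever `(v'-v)/|v'-v| ∈ A`, with `λ` and `μ` depending
only on `N`, `γ`, `ν`, the macroscopic constants and `R`. -/
theorem kernel_cone_lower_bound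
    (N : ℕ) (hN : 2 ≤ N) (γ ν R M₁ M₀ E₀ H₀ : ℝ)
    (hγ : -(N : ℝ) < γ) (hν : ν ∈ Ioo (0:ℝ) 2) (hR : 0 < R)
    (hM₁ : 0 < M₁) (hM : M₁ ≤ M₀) (hE₀ : 0 < E₀) :
    ∃ lam mu : ℝ, 0 < lam ∧ 0 < mu ∧
      ∀ f : EuclideanSpace ℝ (Fin N) → ℝ,
        Measurable f → (∀ v, 0 ≤ f v) →
        MacroBounds N f M₁ M₀ E₀ H₀ →
        ∀ v ∈ ball (0 : EuclideanSpace ℝ (Fin N)) R,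
          ∃ A : Set (EuclideanSpace ℝ (Fin N)),
            A ⊆ sphere (0 : EuclideanSpace ℝ (Fin N)) 1 ∧ MeasurableSet A ∧
            A = -A ∧
            ENNReal.ofReal mu ≤ μH[(N : ℝ) - 1] A ∧
            ∀ v' : EuclideanSpace ℝ (Fin N), v' ≠ v → ‖v' - v‖⁻¹ • (v' - v) ∈ A →
              ENNReal.ofReal (lam * ‖v' - v‖ ^ (-(N : ℝ) - ν)) ≤ Kbar N γ ν f v v' := by
  obtain ⟨m, rfl⟩ : ∃ m, N = m + 2 := ⟨N - 2, by omega⟩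
  obtain ⟨r, d, l, c, hr, hd, hl, hc, hlevel⟩ :=
    exists_volume_levelSet_ge m R M₁ M₀ E₀ H₀ hR hM₁ hE₀
  set L := (m + 1) * r / d + 1
  have hfrac : 0 ≤ (m + 1) * r / d := by positivity
  have hL1 : 1 ≤ L := by linarith
  have hL0 : 0 < L := by linarith
  set q := min (d ^ (γ + ν + 1)) (r ^ (γ + ν + 1))
  have hq0 : 0 < q := lt_min (by positivity) (by positivity)
  set P := (2 * (1 + ((m + 1 : ℕ) : ℝ) * L ^ 2)) ^ ((m + 1 : ℕ) : ℝ) with hP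
  have hP0 : 0 < P := by positivity
  have hdim : (((m + 2 : ℕ) : ℝ) - 1) = ((m + 1 : ℕ) : ℝ) := by
    push_cast
    ring
  refine ⟨l * q * (c / (4 * r * L)), c / (2 * r * (2 * r) ^ (m + 1)) / P, by positivity,
    by positivity, fun f hf hf0 hmac v hv => ?_⟩
  obtain ⟨S, hSm, hcS, hS⟩ := hlevel f hf hf0 hmac v hv
  obtain ⟨Y, hYbox, hYm, hYvol, hYG⟩ := volume_slopes_ge hr hd hL0 (by linarith) hc hSm
    (fun u hu => ⟨fun i => (PiLp.norm_apply_le u i).trans (hS u hu).1, (hS u hu).2.1⟩) hcS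
  refine ⟨normalDirections Y, fun e he => he.1, measurableSet_normalDirections hYm,
    (neg_normalDirections Y).symm, ?_, fun v' hne hv' => ?_⟩
  · have hYL : ∀ y ∈ Y, ∀ i, |y i| ≤ L := fun y hy => by
      have h := mem_slopeBox.1 (hYbox hy)
      refine Fin.cases h.1 fun i => ?_
      rw [abs_of_nonneg (h.2 i).1]
      exact (h.2 i).2.trans hL1
    have h := hYvol.trans (volume_le_mul_hausdorffMeasure_normalDirections hYL)
    rw [ENNReal.ofReal_rpow_of_pos (by positivity), ← hP] at h
    rw [hdim, ENNReal.ofReal_div_of_pos hP0]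
    exact ENNReal.div_le_of_le_mul' h
  · have hpos : 0 < ‖v' - v‖ := norm_pos_iff.2 (sub_ne_zero.2 hne)
    obtain ⟨-, h0, hslope⟩ := hv'
    rw [normalSlope_smul (inv_pos.2 hpos).ne'] at hslope
    have h0' : (v' - v) 0 ≠ 0 := fun h => h0 (by rw [PiLp.smul_apply, h, smul_zero])
    have hb : ∀ u ∈ S, l * q ≤ f (v + u) * ‖u‖ ^ (γ + ν + 1) := fun u hu => by
      obtain ⟨h1, h2, h3⟩ := hS u hu
      exact mul_le_mul h3 (min_rpow_le_rpow _ hd (h2.trans (PiLp.norm_apply_le u 1)) h1) hq0.le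
        (hf0 _)
    refine le_trans ?_ (mul_volume_section_le_Kbar (γ := γ) (ν := ν) hf hSm hb h0')
    rw [mul_comm, ENNReal.ofReal_mul (by positivity), ENNReal.ofReal_mul (by positivity)]
    gcongr
    exact hYG _ hslope
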